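/- arXiv:math/0702876 — 2 statements merged into one kernel-verified Lean document; each statement's English description precedes it below -/
import Mathlib

section
/- For all integers n ≥ 1 and t ≥ 1, the binomial coefficient C(n+t−1, t) equals Σ_{p=1}^{t} (−1)^{t−p} Σ ∏_{j=1}^{p} C(n, i_j), where the inner sum is over all tuples (i_1,…,i_p) of positive integers with i_1+⋯+i_p = t. -/
open scoped TensorProduct DirectSum

noncomputable section

namespace KoszulInvert

variable (k : Type*) [Field k] (V : Type*) [AddCommGroup V] [Module k V]

/-- The coefficients of a power of a power series, as sums over tuples of exponents. -/
theorem coeff_pow_eq_sum_antidiagonalTuple {R : Type*} [CommSemiring R] (φ : PowerSeries R)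
    (p t : ℕ) :
    PowerSeries.coeff t (φ ^ p) =
      ∑ f ∈ Finset.Nat.antidiagonalTuple p t, ∏ j, PowerSeries.coeff (f j) φ := by
  rw [← Fin.prod_const, PowerSeries.coeff_prod]
  refine Finset.sum_equiv Finsupp.equivFunOnFinite (fun l => ?_) (fun l _ => rfl)
  simp [Finset.Nat.mem_antidiagonalTuple, Finset.mem_finsuppAntidiag]

/-- If `φ` has no constant term, then `φ ^ p` only involves tuples of positive exponents. -/
theorem coeff_pow_eq_sum_filter_pos {R : Type*} [CommSemiring R] {φ : PowerSeries R}
    (hφ : PowerSeries.constantCoeff φ = 0) (p t : ℕ) :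
    PowerSeries.coeff t (φ ^ p) =
      ∑ f ∈ (Finset.Nat.antidiagonalTuple p t).filter (fun f => ∀ j, 0 < f j),
        ∏ j, PowerSeries.coeff (f j) φ := by
  rw [coeff_pow_eq_sum_antidiagonalTuple]
  refine (Finset.sum_filter_of_ne fun f _ hf j => Nat.pos_of_ne_zero fun hj => hf ?_).symm
  exact Finset.prod_eq_zero (Finset.mem_univ j) (by simpa [hj] using hφ)

theorem coeff_one_sub_X_pow {R : Type*} [CommRing R] (n i : ℕ) :
    PowerSeries.coeff i ((1 - PowerSeries.X : PowerSeries R) ^ n) = (-1) ^ i * n.choose i := by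
  have h : (1 - PowerSeries.X : PowerSeries R) ^ n =
      PowerSeries.rescale (-1) (((1 + Polynomial.X : Polynomial R) ^ n : Polynomial R)) := by
    simp [PowerSeries.rescale_X, sub_eq_add_neg]
  rw [h, PowerSeries.coeff_rescale, Polynomial.coeff_coe, Polynomial.coeff_one_add_X_pow]

/-- The coefficients of the powers of `1 - (1 - X) ^ n`. -/
theorem coeff_one_sub_one_sub_X_pow_pow {R : Type*} [CommRing R] (n : ℕ) {p t : ℕ} (hpt : p ≤ t) :
    PowerSeries.coeff t ((1 - (1 - PowerSeries.X : PowerSeries R) ^ n) ^ p) =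
      (-1) ^ (t - p) *
        ∑ f ∈ (Finset.Nat.antidiagonalTuple p t).filter (fun f => ∀ j, 0 < f j),
          ∏ j, (n.choose (f j) : R) := by
  rw [coeff_pow_eq_sum_filter_pos (by simp), Finset.mul_sum]
  refine Finset.sum_congr rfl fun f hf => ?_
  obtain ⟨hsum, hpos⟩ := Finset.mem_filter.mp hf
  rw [Finset.Nat.mem_antidiagonalTuple] at hsum
  have hcoeff (j : Fin p) :
      PowerSeries.coeff (f j) (1 - (1 - PowerSeries.X : PowerSeries R) ^ n) =
        (-1) * (-1) ^ f j * (n.choose (f j) : R) := by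
    simp [coeff_one_sub_X_pow, PowerSeries.coeff_one, (hpos j).ne']
  have hsign : (-1 : R) ^ p * (-1) ^ t = (-1) ^ (t - p) := by
    obtain ⟨d, rfl⟩ := Nat.exists_eq_add_of_le hpt
    rw [pow_add, ← mul_assoc, ← mul_pow]
    simp
  simp_rw [hcoeff, Finset.prod_mul_distrib, Finset.prod_pow_eq_pow_sum, hsum, Fin.prod_const,
    hsign]

/-- For all `n ≥ 1` and `t ≥ 1`:
`C(n+t−1, t) = Σ_{p=1}^{t} (−1)^{t−p} Σ_{i_1+⋯+i_p = t, i_j ≥ 1} Π_j C(n, i_j)`. -/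
theorem choose_eq_alternating_sum_compositions (n t : ℕ) (hn : 1 ≤ n) (ht : 1 ≤ t) :
    ((n + t - 1).choose t : ℤ) =
      ∑ p ∈ Finset.Icc 1 t, (-1 : ℤ) ^ (t - p) *
        ∑ f ∈ (Finset.Nat.antidiagonalTuple p t).filter (fun f => ∀ j, 0 < f j),
          ∏ j, (n.choose (f j) : ℤ) := by
  obtain ⟨d, rfl⟩ := Nat.exists_eq_add_of_le' hn
  set S : PowerSeries ℤ := PowerSeries.mk fun i => ((d + i).choose d : ℤ)
  set F : PowerSeries ℤ := 1 - (1 - PowerSeries.X) ^ (d + 1) with hF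
  have hS : S * (1 - F) = 1 := by
    rw [hF, sub_sub_cancel]
    exact PowerSeries.mk_add_choose_mul_one_sub_pow_eq_one ℤ d
  have hgeom : S = ∑ p ∈ Finset.range (t + 1), F ^ p + S * F ^ (t + 1) := by
    linear_combination (∑ p ∈ Finset.range (t + 1), F ^ p) * hS + S * geom_sum_mul F (t + 1)
  have hrem : PowerSeries.coeff t (S * F ^ (t + 1)) = 0 := by
    have hX : PowerSeries.X ∣ F := PowerSeries.X_dvd_iff.mpr (by simp [hF])
    exact PowerSeries.X_pow_dvd_iff.mp (Dvd.dvd.mul_left (pow_dvd_pow_of_dvd hX _) S) t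
      t.lt_succ_self
  calc
    ((d + 1 + t - 1).choose t : ℤ) = PowerSeries.coeff t S := by
      rw [PowerSeries.coeff_mk, Nat.choose_symm_add, Nat.add_right_comm, Nat.add_sub_cancel]
    _ = ∑ p ∈ Finset.range (t + 1), PowerSeries.coeff t (F ^ p) := by
      rw [hgeom, map_add, hrem, add_zero, map_sum]
    _ = ∑ p ∈ Finset.Icc 1 t, PowerSeries.coeff t (F ^ p) := by
      rw [Finset.range_eq_Ico, Finset.sum_eq_sum_Ico_succ_bot t.succ_pos, pow_zero,
        PowerSeries.coeff_one, if_neg (by lia), zero_add]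
      rfl
    _ = _ := Finset.sum_congr rfl fun p hp =>
      coeff_one_sub_one_sub_X_pow_pow _ (Finset.mem_Icc.mp hp).2

end KoszulInvert
end
end

section
/- Let Λ = ∧(V*) be the exterior algebra on the dual space V*, and regard k as a left Λ-module via the augmentation map ε: Λ → k (the projection killing all positive-degree components). Then for every t ≥ 0 there is an isomorphism of k-vector spaces Ext^t_Λ(k, k) ≅ S^t V; in particular Ext^t_Λ(k,k) has dimension C(n+t−1, t). -/
open scoped TensorProduct DirectSum

noncomputable section

namespace KoszulInvert

universe u

variable (k : Type u) [Field k] (V : Type u) [AddCommGroup V] [Module k V]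

/-- The subspace of the `t`-th tensor power of `V` spanned by all differences
`v_1 ⊗ ⋯ ⊗ v_t - v_{σ(1)} ⊗ ⋯ ⊗ v_{σ(t)}` for permutations `σ`. -/
def symSub (t : ℕ) : Submodule k (⨂[k]^t V) :=
  Submodule.span k {x | ∃ (v : Fin t → V) (σ : Equiv.Perm (Fin t)),
    x = PiTensorProduct.tprod k v - PiTensorProduct.tprod k (fun j => v (σ j))}

/-- The `t`-th symmetric power `S^t V` of `V`, as the quotient of the `t`-th tensor power of
`V` by the relations identifying a tensor with its permutations. -/
abbrev SymPow (t : ℕ) : Type _ := (⨂[k]^t V) ⧸ symSub k V t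

/-- `k` as a module over the exterior algebra `Λ = ⋀(V^*)` via the augmentation map
`ε : Λ → k` (the projection killing all positive-degree components). -/
instance augModule : Module (ExteriorAlgebra k (Module.Dual k V)) k :=
  Module.compHom k (ExteriorAlgebra.algebraMapInv (R := k) (M := Module.Dual k V)).toRingHom

section Complex

variable {ι : Type*} {A : Type*} [Ring A]

open Classical in
/-- The homotopy that contracts the Koszul complex in the direction of the variable `i`. -/
def koszulHomotopy (d : A →+ A) (i : ι) (m : ℕ) (f : Sym ι m → A) (s : Sym ι (m + 1)) : A :=
  if h : i ∈ s then d (f (s.erase i h)) else 0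

lemma koszulHomotopy_cons_self (d : A →+ A) (i : ι) (m : ℕ) (f : Sym ι m → A) (s : Sym ι m) :
    koszulHomotopy d i m f (i ::ₛ s) = d (f s) := by
  simp [koszulHomotopy]

lemma koszulHomotopy_of_notMem (d : A →+ A) (i : ι) (m : ℕ) (f : Sym ι m → A)
    (s : Sym ι (m + 1)) (h : i ∉ s) : koszulHomotopy d i m f s = 0 := by
  simp [koszulHomotopy, h]

variable [Fintype ι]

/-- The Koszul differential `f ↦ (s ↦ ∑ i, f (i ::ₛ s) * x i)`, as a map of free left modules
with bases indexed by monomials. -/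
def koszulD (x : ι → A) (m : ℕ) : (Sym ι (m + 1) → A) →ₗ[A] (Sym ι m → A) where
  toFun f s := ∑ i, f (i ::ₛ s) * x i
  map_add' f g := by ext s; simp [add_mul, Finset.sum_add_distrib]
  map_smul' a f := by ext s; simp [mul_assoc, Finset.mul_sum]

lemma koszulD_apply (x : ι → A) (m : ℕ) (f : Sym ι (m + 1) → A) (s : Sym ι m) :
    koszulD x m f s = ∑ i, f (i ::ₛ s) * x i := rfl

lemma koszulD_koszulD {x : ι → A} (hx : ∀ i, x i * x i = 0)
    (hxx : ∀ i j, x i * x j + x j * x i = 0) (m : ℕ) (f : Sym ι (m + 2) → A) :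
    koszulD x m (koszulD x (m + 1) f) = 0 := by
  ext s
  simp only [koszulD_apply, Finset.sum_mul, Pi.zero_apply]
  rw [← Finset.sum_product' (f := fun i j => f (j ::ₛ i ::ₛ s) * x j * x i)]
  refine Finset.sum_involution (fun p _ => p.swap) ?_ ?_ (by simp) (by simp)
  · rintro ⟨i, j⟩ -
    simp only [Prod.swap, mul_assoc]
    rw [Sym.cons_swap, ← mul_add, hxx, mul_zero]
  · rintro ⟨i, j⟩ - h h'
    obtain rfl : j = i := (Prod.ext_iff.1 h').1
    exact h (by rw [mul_assoc, hx, mul_zero])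

variable [DecidableEq ι]

lemma koszulD_koszulHomotopy_of_notMem {x : ι → A} {d : A →+ A} {i : ι}
    (hd : ∀ a j, d (a * x j) = (if i = j then a else 0) - d a * x j) (m : ℕ)
    (f : Sym ι (m + 1) → A) (s : Sym ι (m + 1)) (hs : i ∉ s) :
    koszulD x (m + 1) (koszulHomotopy d i (m + 1) f) s = f s - d (f s * x i) := by
  rw [koszulD_apply, Finset.sum_eq_single i]
  · simp [koszulHomotopy_cons_self, hd]
  · intro j _ hj
    rw [koszulHomotopy_of_notMem, zero_mul]
    simp [hs, Ne.symm hj]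
  · simp

lemma koszulD_koszulHomotopy_of_mem {x : ι → A} {d : A →+ A} {i : ι}
    (hd : ∀ a j, d (a * x j) = (if i = j then a else 0) - d a * x j) (m : ℕ)
    (f : Sym ι (m + 1) → A) (hf : koszulD x m f = 0) (s : Sym ι (m + 1)) (hs : i ∈ s) :
    koszulD x (m + 1) (koszulHomotopy d i (m + 1) f) s = f s := by
  obtain ⟨t, rfl⟩ := Sym.exists_cons_of_mem hs
  have key : ∀ j, koszulHomotopy d i (m + 1) f (j ::ₛ i ::ₛ t) = d (f (j ::ₛ t)) := fun j => by
    rw [Sym.cons_swap, koszulHomotopy_cons_self]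
  have h0 := congrArg d (congrFun hf t)
  simp only [koszulD_apply, map_sum, hd, Finset.sum_sub_distrib, Pi.zero_apply, map_zero,
    Finset.sum_ite_eq, Finset.mem_univ, if_true] at h0
  simp only [koszulD_apply, key]
  exact (sub_eq_zero.1 h0).symm

/-- The Koszul complex is exact in positive degrees, provided that right multiplication by each
`x i` admits a contraction `d i` satisfying the Clifford relations. -/
lemma exists_koszulD_eq {x : ι → A} {d : ι → A →+ A} (hx : ∀ i, x i * x i = 0)
    (hxx : ∀ i j, x i * x j + x j * x i = 0)
    (hd : ∀ i a j, d i (a * x j) = (if i = j then a else 0) - d i a * x j) (m : ℕ)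
    (f : Sym ι (m + 1) → A) (hf : koszulD x m f = 0) : ∃ g, koszulD x (m + 1) g = f := by
  have key : ∀ T : Finset ι, ∃ g, koszulD x m (f - koszulD x (m + 1) g) = 0 ∧
      ∀ s : Sym ι (m + 1), ∀ i ∈ T, i ∈ s → f s - koszulD x (m + 1) g s = 0 := by
    intro T
    induction T using Finset.induction_on with
    | empty => exact ⟨0, by simpa using hf, by simp⟩
    | insert i T _ ih =>
      obtain ⟨g, hg, hgT⟩ := ih
      refine ⟨g + koszulHomotopy (d i) i (m + 1) (f - koszulD x (m + 1) g), ?_, ?_⟩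
      · rw [map_add, ← sub_sub, map_sub, koszulD_koszulD hx hxx, hg, sub_zero]
      · intro s j hj hjs
        rw [map_add, Pi.add_apply, ← sub_sub]
        by_cases his : i ∈ s
        · rw [koszulD_koszulHomotopy_of_mem (hd i) m _ hg s his]
          simp
        · have hjT : j ∈ T := by
            rcases Finset.mem_insert.1 hj with rfl | h
            · exact absurd hjs his
            · exact h
          rw [koszulD_koszulHomotopy_of_notMem (hd i) m _ s his, Pi.sub_apply,
            hgT s j hjT hjs]
          simp
  obtain ⟨g, -, hg⟩ := key Finset.univ
  refine ⟨g, funext fun s => ?_⟩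
  obtain ⟨i, t, rfl⟩ := Sym.exists_eq_cons_of_succ s
  exact (sub_eq_zero.1 (hg _ i (Finset.mem_univ i) (Sym.mem_cons_self i t))).symm

end Complex

section SymPow

variable {k V}

lemma exists_perm_of_perm_ofFn {ι : Type*} [LinearOrder ι] {t : ℕ} {f g : Fin t → ι}
    (h : (List.ofFn f).Perm (List.ofFn g)) : ∃ σ : Equiv.Perm (Fin t), g = f ∘ σ := by
  have key : f ∘ Tuple.sort f = g ∘ Tuple.sort g := by
    refine List.ofFn_injective (List.Perm.eq_of_pairwise' (r := (· ≤ ·)) ?_ ?_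
      (((Tuple.sort f).ofFn_comp_perm f).trans (h.trans ((Tuple.sort g).ofFn_comp_perm g).symm)))
    · exact (Tuple.monotone_sort f).sortedLE_ofFn.pairwise
    · exact (Tuple.monotone_sort g).sortedLE_ofFn.pairwise
  refine ⟨(Tuple.sort g).symm.trans (Tuple.sort f), funext fun i => ?_⟩
  simpa using (congrFun key ((Tuple.sort g).symm i)).symm

/-- The monomial attached to a word. -/
def symOfFn {ι : Type*} {t : ℕ} (f : Fin t → ι) : Sym ι t :=
  ⟨List.ofFn f, by simp⟩

lemma symOfFn_comp_perm {ι : Type*} {t : ℕ} (f : Fin t → ι) (σ : Equiv.Perm (Fin t)) :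
    symOfFn (f ∘ σ) = symOfFn f :=
  Subtype.ext (Multiset.coe_eq_coe.2 (σ.ofFn_comp_perm f))

lemma symOfFn_surjective {ι : Type*} {t : ℕ} :
    Function.Surjective (symOfFn : (Fin t → ι) → Sym ι t) := by
  rintro ⟨s, rfl⟩
  induction s using Quotient.inductionOn with
  | h l =>
    exact ⟨l.get, Subtype.ext (congrArg (fun l : List ι => (l : Multiset ι)) (List.ofFn_get l))⟩

/-- The map from the tensor power to the free module on monomials given by a basis. -/
def tensorToSym {ι : Type*} [Finite ι] (b : Module.Basis ι k V) (t : ℕ) :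
    (⨂[k]^t V) →ₗ[k] (Sym ι t →₀ k) :=
  (Basis.piTensorProduct fun _ : Fin t => b).constr k fun f => Finsupp.single (symOfFn f) 1

lemma tensorToSym_tprod {ι : Type*} [Finite ι] (b : Module.Basis ι k V) (t : ℕ)
    (f : Fin t → ι) :
    tensorToSym b t (PiTensorProduct.tprod k fun j => b (f j)) =
      Finsupp.single (symOfFn f) 1 := by
  rw [← Basis.piTensorProduct_apply, tensorToSym, Module.Basis.constr_basis]

lemma symSub_le_ker {ι : Type*} [Finite ι] (b : Module.Basis ι k V) (t : ℕ) :
    symSub k V t ≤ LinearMap.ker (tensorToSym b t) := by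
  refine Submodule.span_le.2 ?_
  rintro _ ⟨v, σ, rfl⟩
  rw [SetLike.mem_coe, LinearMap.mem_ker, map_sub, sub_eq_zero]
  have h : (tensorToSym b t).compMultilinearMap (PiTensorProduct.tprod k) =
      ((tensorToSym b t).compMultilinearMap (PiTensorProduct.tprod k)).domDomCongr σ := by
    refine Module.Basis.ext_multilinear (fun _ => b) fun f => ?_
    simp only [LinearMap.compMultilinearMap_apply, MultilinearMap.domDomCongr_apply]
    rw [tensorToSym_tprod, tensorToSym_tprod b t (fun j => f (σ j))]
    exact congrArg (Finsupp.single · 1) (symOfFn_comp_perm f σ).symm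
  exact DFunLike.congr_fun h v

/-- A basis of `V` identifies `S^t V` with the free module on monomials of degree `t`. -/
def symPowEquiv {ι : Type*} [Finite ι] [LinearOrder ι] (b : Module.Basis ι k V) (t : ℕ) :
    SymPow k V t ≃ₗ[k] (Sym ι t →₀ k) :=
  LinearEquiv.ofLinearMap ((symSub k V t).liftQ (tensorToSym b t) (symSub_le_ker b t))
    (Finsupp.linearCombination k fun s => (symSub k V t).mkQ
      (PiTensorProduct.tprod k fun j => b (Function.surjInv symOfFn_surjective s j)))
    (by
      ext s : 3
      simp [tensorToSym_tprod, Function.surjInv_eq])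
    (by
      refine Submodule.linearMap_qext _ ((Basis.piTensorProduct fun _ : Fin t => b).ext
        fun f => ?_)
      have hf := Function.surjInv_eq symOfFn_surjective (symOfFn f)
      obtain ⟨σ, hσ⟩ := exists_perm_of_perm_ofFn
        (Multiset.coe_eq_coe.1 (congrArg Subtype.val hf))
      simp only [Basis.piTensorProduct_apply, LinearMap.comp_apply, LinearMap.id_apply,
        Submodule.mkQ_apply, Submodule.liftQ_apply, tensorToSym_tprod,
        Finsupp.linearCombination_single, one_smul]
      rw [Submodule.Quotient.eq]
      refine Submodule.subset_span
        ⟨fun j => b (Function.surjInv symOfFn_surjective (symOfFn f) j), σ, ?_⟩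
      congr 2
      funext j
      exact congrArg b (congrFun hσ j))

end SymPow

section Exterior

variable {k} {ι : Type*} {M : Type*} [AddCommGroup M] [Module k M]

/-- Right contraction of the exterior algebra against a linear form. -/
def contractR (c : Module.Dual k M) : ExteriorAlgebra k M →+ ExteriorAlgebra k M :=
  ((CliffordAlgebra.contractRight (Q := (0 : QuadraticForm k M))).flip c).toAddMonoidHom

lemma contractR_mul_ι [DecidableEq ι] (b : Module.Basis ι k M) (i : ι)
    (a : ExteriorAlgebra k M) (j : ι) :
    contractR (b.coord i) (a * ExteriorAlgebra.ι k (b j)) =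
      (if i = j then a else 0) - contractR (b.coord i) a * ExteriorAlgebra.ι k (b j) := by
  refine (CliffordAlgebra.contractRight_mul_ι (b.coord i) (b j) a).trans ?_
  congr 1
  by_cases h : i = j
  · subst h; simp
  · simp [h, Finsupp.single_eq_of_ne]

variable [Fintype ι]

lemma exists_eq_aug_add_sum (b : Module.Basis ι k M) (y : ExteriorAlgebra k M) :
    ∃ c : ι → ExteriorAlgebra k M,
      y = algebraMap k _ (ExteriorAlgebra.algebraMapInv y) +
        ∑ i, c i * ExteriorAlgebra.ι k (b i) := by
  induction y using CliffordAlgebra.right_induction with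
  | algebraMap r =>
    exact ⟨0, by simp [ExteriorAlgebra.algebraMap_leftInverse M r]⟩
  | add y z hy hz =>
    obtain ⟨c, hc⟩ := hy
    obtain ⟨c', hc'⟩ := hz
    refine ⟨c + c', ?_⟩
    nth_rewrite 1 [hc, hc']
    simp only [map_add, Pi.add_apply, add_mul, Finset.sum_add_distrib]
    abel
  | mul_ι m y _ =>
    refine ⟨fun i => b.repr m i • y, ?_⟩
    have h0 : ExteriorAlgebra.algebraMapInv (y * CliffordAlgebra.ι 0 m) = 0 := by
      rw [map_mul]
      simp [ExteriorAlgebra.algebraMapInv]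
    rw [h0, map_zero, zero_add]
    nth_rewrite 1 [← b.sum_repr m]
    simp only [map_sum, map_smul, Finset.mul_sum, mul_smul_comm, smul_mul_assoc, ExteriorAlgebra.ι]

end Exterior

section Resolution

open CategoryTheory

variable {k V} {ι : Type}

lemma aug_smul (a : ExteriorAlgebra k (Module.Dual k V)) (c : k) :
    a • c = ExteriorAlgebra.algebraMapInv a * c := rfl

lemma aug_ι_smul (m : Module.Dual k V) (c : k) : ExteriorAlgebra.ι k m • c = 0 := by
  simp [aug_smul, ExteriorAlgebra.algebraMapInv]

/-- The augmentation of the Koszul complex. -/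
def koszulAug (ι : Type) : (Sym ι 0 → ExteriorAlgebra k (Module.Dual k V))
    →ₗ[ExteriorAlgebra k (Module.Dual k V)] k where
  toFun f := f Sym.nil • (1 : k)
  map_add' f g := by rw [Pi.add_apply, add_smul]
  map_smul' a f := by rw [Pi.smul_apply, smul_eq_mul, mul_smul, RingHom.id_apply]

lemma koszulAug_apply (f : Sym ι 0 → ExteriorAlgebra k (Module.Dual k V)) :
    koszulAug ι f = ExteriorAlgebra.algebraMapInv (f Sym.nil) := by
  simp [koszulAug, aug_smul]

lemma koszulAug_surjective :
    Function.Surjective (koszulAug (k := k) (V := V) ι) := fun c =>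
  ⟨fun _ => algebraMap k _ c, by
    rw [koszulAug_apply, ExteriorAlgebra.algebraMap_leftInverse _ c]⟩

variable (b : Module.Basis ι k (Module.Dual k V))

/-- The generators of the exterior algebra given by a basis. -/
def extGen (i : ι) : ExteriorAlgebra k (Module.Dual k V) := ExteriorAlgebra.ι k (b i)

lemma extGen_sq (i : ι) : extGen b i * extGen b i = 0 := ExteriorAlgebra.ι_sq_zero _

lemma extGen_anticomm (i j : ι) : extGen b i * extGen b j + extGen b j * extGen b i = 0 :=
  ExteriorAlgebra.ι_add_mul_swap _ _

lemma extGen_smul (i : ι) (c : k) : extGen b i • c = 0 := aug_ι_smul _ _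

variable [Fintype ι]

lemma koszulAug_koszulD (f) : koszulAug ι (koszulD (extGen b) 0 f) = 0 := by
  simp only [koszulAug, LinearMap.coe_mk, AddHom.coe_mk, koszulD_apply, Finset.sum_smul, mul_smul,
    extGen_smul, smul_zero, Finset.sum_const_zero]

lemma exists_koszulD_eq_of_koszulAug_eq_zero (f) (hf : koszulAug ι f = 0) :
    ∃ g, koszulD (extGen b) 0 g = f := by
  obtain ⟨c, hc⟩ := exists_eq_aug_add_sum b (f Sym.nil)
  rw [koszulAug_apply] at hf
  rw [hf, map_zero, zero_add] at hc
  refine ⟨fun s => c (Sym.oneEquiv.symm s), funext fun s => ?_⟩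
  rw [Subsingleton.elim s Sym.nil, hc, koszulD_apply]
  refine Finset.sum_congr rfl fun i _ => ?_
  rw [show i ::ₛ Sym.nil = Sym.oneEquiv i from rfl, Equiv.symm_apply_apply]
  rfl

/-- The Koszul complex as a chain complex of left modules over the exterior algebra. -/
def koszulComplex : ChainComplex (ModuleCat.{u} (ExteriorAlgebra k (Module.Dual k V))) ℕ :=
  ChainComplex.of (fun m => ModuleCat.of _ (Sym ι m → ExteriorAlgebra k (Module.Dual k V)))
    (fun m => ModuleCat.ofHom (koszulD (extGen b) m)) fun m => by
      ext f : 2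
      exact koszulD_koszulD (extGen_sq b) (extGen_anticomm b) m f

lemma koszulComplex_d (m : ℕ) :
    (koszulComplex b).d (m + 1) m = ModuleCat.ofHom (koszulD (extGen b) m) :=
  ChainComplex.of_d
    (fun m => ModuleCat.of _ (Sym ι m → ExteriorAlgebra k (Module.Dual k V)))
    (fun m => ModuleCat.ofHom (koszulD (extGen b) m)) m

lemma koszulComplex_exactAt_succ (m : ℕ) : (koszulComplex b).ExactAt (m + 1) := by
  classical
  rw [HomologicalComplex.exactAt_iff' _ (m + 1 + 1) (m + 1) m (by simp) (by simp)]
  rw [ShortComplex.moduleCat_exact_iff]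
  intro f hf
  change (koszulComplex b).d (m + 1) m f = 0 at hf
  change ∃ g, (koszulComplex b).d (m + 1 + 1) (m + 1) g = f
  rw [koszulComplex_d] at hf ⊢
  exact exists_koszulD_eq (extGen_sq b) (extGen_anticomm b)
    (d := fun i => contractR (b.coord i)) (fun i a j => contractR_mul_ι b i a j) m f hf

/-- The augmentation of the Koszul complex as a chain map. -/
def koszulπ : koszulComplex b ⟶ (ChainComplex.single₀ _).obj
    (ModuleCat.of (ExteriorAlgebra k (Module.Dual k V)) k) :=
  (ChainComplex.toSingle₀Equiv _ _).symm ⟨ModuleCat.ofHom (koszulAug ι), by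
    rw [koszulComplex_d]
    ext f : 2
    exact koszulAug_koszulD b f⟩

lemma koszulπ_f_zero : (koszulπ b).f 0 = ModuleCat.ofHom (koszulAug ι) :=
  ChainComplex.toSingle₀Equiv_symm_apply_f_zero _ _

lemma koszulπ_quasiIsoAt_zero : QuasiIsoAt (koszulπ b) 0 := by
  rw [ChainComplex.quasiIsoAt₀_iff, ShortComplex.quasiIso_iff_of_zeros' _ rfl rfl rfl]
  constructor
  · rw [ShortComplex.moduleCat_exact_iff]
    intro f hf
    change (koszulπ b).f 0 f = 0 at hf
    change ∃ g, (koszulComplex b).d 1 0 g = f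
    rw [koszulπ_f_zero] at hf
    rw [koszulComplex_d]
    exact exists_koszulD_eq_of_koszulAug_eq_zero b f hf
  · change Epi ((koszulπ b).f 0)
    rw [koszulπ_f_zero]
    exact (ModuleCat.epi_iff_surjective (ModuleCat.ofHom (koszulAug (k := k) (V := V) ι))).2
      koszulAug_surjective

lemma koszulπ_quasiIso : QuasiIso (koszulπ b) where
  quasiIsoAt m := by
    cases m with
    | zero => exact koszulπ_quasiIsoAt_zero b
    | succ m =>
      rw [quasiIsoAt_iff_exactAt']
      · apply koszulComplex_exactAt_succ
      · apply ChainComplex.exactAt_succ_single_obj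

lemma koszulComplex_projective (m : ℕ) : Projective ((koszulComplex b).X m) := by
  classical
  exact ModuleCat.projective_of_free
    (Pi.basisFun (ExteriorAlgebra k (Module.Dual k V)) (Sym ι m))

/-- The Koszul resolution of `k` over the exterior algebra. -/
def koszulResolution : ProjectiveResolution
    (ModuleCat.of (ExteriorAlgebra k (Module.Dual k V)) k) where
  complex := koszulComplex b
  projective := koszulComplex_projective b
  π := koszulπ b
  quasiIso := koszulπ_quasiIso b

open Classical in
lemma koszulFunctional_apply {m : ℕ} (φ : (Sym ι m → ExteriorAlgebra k (Module.Dual k V))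
    →ₗ[ExteriorAlgebra k (Module.Dual k V)] k) (g) :
    φ g = ∑ s, g s • φ (Pi.single s 1) := by
  refine (congrArg φ (pi_eq_sum_univ' g)).trans ?_
  rw [map_sum]
  refine Finset.sum_congr rfl fun s _ => ?_
  rw [map_smul]

lemma koszulFunctional_koszulD {m : ℕ} (φ : (Sym ι m → ExteriorAlgebra k (Module.Dual k V))
    →ₗ[ExteriorAlgebra k (Module.Dual k V)] k) (f) : φ (koszulD (extGen b) m f) = 0 := by
  classical
  rw [koszulFunctional_apply]
  refine Finset.sum_eq_zero fun s _ => ?_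
  rw [koszulD_apply, Finset.sum_smul]
  refine Finset.sum_eq_zero fun i _ => ?_
  rw [mul_smul, extGen_smul, smul_zero]

open Classical in
/-- Homomorphisms from a free module of the Koszul complex to `k`. -/
def koszulHomEquiv (m : ℕ) :
    ((koszulComplex b).X m ⟶ ModuleCat.of (ExteriorAlgebra k (Module.Dual k V)) k) ≃ₗ[k]
      (Sym ι m → k) where
  toFun φ s := φ.hom (Pi.single s 1 : Sym ι m → ExteriorAlgebra k (Module.Dual k V))
  map_add' _ _ := rfl
  map_smul' c φ := by
    ext s
    exact congrArg
      (fun z : k => z * (φ.hom (Pi.single s 1 : Sym ι m → ExteriorAlgebra k (Module.Dual k V)) : k))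
      (ExteriorAlgebra.algebraMap_leftInverse (R := k) (Module.Dual k V) c)
  invFun c := ModuleCat.ofHom
    (Fintype.linearCombination (ExteriorAlgebra k (Module.Dual k V)) c :
      (Sym ι m → ExteriorAlgebra k (Module.Dual k V))
        →ₗ[ExteriorAlgebra k (Module.Dual k V)] k)
  left_inv φ := by
    refine ModuleCat.hom_ext (LinearMap.ext fun g => ?_)
    exact (koszulFunctional_apply φ.hom g).symm
  right_inv c := by
    ext s
    exact (Fintype.linearCombination_apply_single _ _ _ _).trans (one_smul _ _)

lemma koszulComplex_linearYonedaObj_d (i j : ℕ) :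
    ((koszulComplex b).linearYonedaObj k
      (ModuleCat.of (ExteriorAlgebra k (Module.Dual k V)) k)).d i j = 0 := by
  by_cases h : i + 1 = j
  · subst h
    ext φ : 2
    change (koszulComplex b).d (i + 1) i ≫ φ = 0
    rw [koszulComplex_d]
    ext f : 2
    exact koszulFunctional_koszulD b φ.hom f
  · exact HomologicalComplex.shape _ _ _ h

/-- Ext groups of `k` over the exterior algebra, computed by the Koszul resolution. -/
def extEquiv (t : ℕ) :
    (((Ext k (ModuleCat (ExteriorAlgebra k (Module.Dual k V))) t).obj
      (Opposite.op (ModuleCat.of (ExteriorAlgebra k (Module.Dual k V)) k))).obj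
      (ModuleCat.of (ExteriorAlgebra k (Module.Dual k V)) k)) ≃ₗ[k] (Sym ι t → k) :=
  ((koszulResolution b).isoExt (R := k) t _ ≪≫
    (HomologicalComplex.isoHomologyπ _ _ t rfl
      (koszulComplex_linearYonedaObj_d b _ _)).symm ≪≫
    HomologicalComplex.iCyclesIso _ t _ rfl
      (koszulComplex_linearYonedaObj_d b _ _)).toLinearEquiv ≪≫ₗ koszulHomEquiv b t

end Resolution

open CategoryTheory in
/-- For every `t ≥ 0` there is an isomorphism of `k`-vector spaces
`Ext^t_Λ(k, k) ≅ S^t V`, where `Λ = ⋀(V^*)` and `k` is a `Λ`-module via the augmentation;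
in particular `Ext^t_Λ(k,k)` has dimension `C(n+t−1, t)`. -/
theorem ext_exterior_algebra_iso_symmetric_power
    (n : ℕ) (hn : 2 ≤ n) [FiniteDimensional k V] (hdim : Module.finrank k V = n) (t : ℕ) :
    Nonempty
      ((((Ext k (ModuleCat (ExteriorAlgebra k (Module.Dual k V))) t).obj
          (Opposite.op (ModuleCat.of (ExteriorAlgebra k (Module.Dual k V)) k))).obj
          (ModuleCat.of (ExteriorAlgebra k (Module.Dual k V)) k)) ≃ₗ[k] SymPow k V t) ∧
    Module.finrank k
      (((Ext k (ModuleCat (ExteriorAlgebra k (Module.Dual k V))) t).obj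
          (Opposite.op (ModuleCat.of (ExteriorAlgebra k (Module.Dual k V)) k))).obj
          (ModuleCat.of (ExteriorAlgebra k (Module.Dual k V)) k)) = (n + t - 1).choose t := by
  have b : Module.Basis (Fin n) k V := Module.finBasisOfFinrankEq k V hdim
  have b' : Module.Basis (Fin n) k (Module.Dual k V) := b.dualBasis
  have e := extEquiv b' t
  refine ⟨⟨e ≪≫ₗ (Finsupp.linearEquivFunOnFinite k k (Sym (Fin n) t)).symm ≪≫ₗ
    (symPowEquiv b t).symm⟩, ?_⟩
  rw [e.finrank_eq, Module.finrank_fintype_fun_eq_card, Sym.card_sym_eq_choose, Fintype.card_fin]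

end KoszulInvert
end
end
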